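/- arXiv:2511.09703 — 2 statements merged into one kernel-verified Lean document; each statement's English description precedes it below -/
import Mathlib

section
/- dim V + r − 1 ≤ dim span(MCol), where r := rank_un(M). -/
open Matrix

/-- Indicator (0/1) column vector of a set of states: `ind S q = 1` iff `q ∈ S`. -/
noncomputable def ind {Q : Type*} (S : Set Q) : Q → ℝ := S.indicator 1

namespace UFA

variable {Q σ : Type*}

/-- `y` is a column of the monoid morphism `M`, i.e. `y = M(w)[q]` for some word `w`, state `q`. -/
def IsCol (M : List σ → Matrix Q Q ℝ) (y : Q → ℝ) : Prop :=
  ∃ w : List σ, ∃ q : Q, y = fun p => M w p q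

/-- `x` is a row of `M`, i.e. `xᵀ = [q]ᵀ M(w)` for some word `w` and state `q`. -/
def IsRow (M : List σ → Matrix Q Q ℝ) (x : Q → ℝ) : Prop :=
  ∃ w : List σ, ∃ q : Q, x = fun p => M w q p

/-- A maximal column: a column `y` such that no column `y' ≠ y` satisfies `y' ≥ y`. -/
def IsMaxCol (M : List σ → Matrix Q Q ℝ) (y : Q → ℝ) : Prop :=
  IsCol M y ∧ ∀ y', IsCol M y' → y ≤ y' → y' = y

/-- A maximal row: a row `x` such that no row `x' ≠ x` satisfies `x' ≥ x`. -/
def IsMaxRow (M : List σ → Matrix Q Q ℝ) (x : Q → ℝ) : Prop :=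
  IsRow M x ∧ ∀ x', IsRow M x' → x ≤ x' → x' = x

/-- Unambiguous rank of a zero-one matrix: the least `r` such that `A = C * R` with `C, R`
zero-one matrices having `r` columns resp. `r` rows. -/
noncomputable def rankUnMat (A : Matrix Q Q ℝ) : ℕ :=
  sInf {r : ℕ | ∃ C : Matrix Q (Fin r) ℝ, ∃ R : Matrix (Fin r) Q ℝ,
    (∀ i j, C i j = 0 ∨ C i j = 1) ∧ (∀ i j, R i j = 0 ∨ R i j = 1) ∧ A = C * R}

/-- Minimum unambiguous rank of the matrix monoid generated by `M`. -/
noncomputable def rankUn (M : List σ → Matrix Q Q ℝ) : ℕ :=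
  sInf (Set.range fun w => rankUnMat (M w))

/-- Minimum real rank of the matrix monoid generated by `M`. -/
noncomputable def rankReal [Fintype Q] (M : List σ → Matrix Q Q ℝ) : ℕ :=
  sInf (Set.range fun w => (M w).rank)

/-- `Mer M q`: the set of states that appear together with `q` in some column. -/
def Mer (M : List σ → Matrix Q Q ℝ) (q : Q) : Set Q :=
  {q' | ∃ S : Set Q, q ∈ S ∧ q' ∈ S ∧ IsCol M (ind S)}

end UFA

namespace UFA

section Monoid

/-- In a monoid, an element with finitely many powers has a nontrivial idempotent power. -/
theorem exists_isIdempotentElem_pow {G : Type*} [Monoid G] (a : G)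
    (h : (Set.range fun n : ℕ => a ^ n).Finite) :
    ∃ n, IsIdempotentElem (a ^ (n + 1)) := by
  obtain ⟨i, j, hij, he⟩ := h.exists_lt_map_eq_of_forall_mem (f := fun n : ℕ => a ^ n)
    (fun n => Set.mem_range_self n)
  obtain ⟨k, rfl⟩ := Nat.exists_eq_add_of_lt hij
  have step : ∀ m, i ≤ m → ∀ t, a ^ (m + (k + 1) * t) = a ^ m := by
    intro m hm t
    induction t with
    | zero => simp
    | succ t ih =>
      obtain ⟨l, rfl⟩ := Nat.exists_eq_add_of_le hm
      rw [show i + l + (k + 1) * (t + 1) = (i + k + 1) + (l + (k + 1) * t) by ring, pow_add,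
        ← he, ← pow_add, ← ih]
      congr 1
      ring
  refine ⟨k * (i + 1) + i, ?_⟩
  have hpos : i ≤ k * (i + 1) + i + 1 := by
    have := Nat.zero_le (k * (i + 1)); omega
  have := step _ hpos (i + 1)
  rw [IsIdempotentElem, ← pow_add]
  calc _ = a ^ (k * (i + 1) + i + 1 + (k + 1) * (i + 1)) := by congr 1; ring
    _ = _ := this

end Monoid

section Averages

/-- If the average of finitely many reals attains an upper bound, every one of them does. -/
theorem eq_of_sum_eq_card_mul {σ : Type*} [Fintype σ] {f : σ → ℝ} {c : ℝ}
    (hle : ∀ a, f a ≤ c) (hsum : ∑ a, f a = Fintype.card σ * c) (a : σ) : f a = c :=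
  (Finset.sum_eq_sum_iff_of_le fun a _ => hle a).1
    (hsum.trans (by simp)) a (Finset.mem_univ a)

/-- Maximum principle: a function on words that is the average of its values at the one-letter
extensions is constant on the extensions of a maximum. -/
theorem eq_append_of_isMax {σ : Type*} [Fintype σ] {F : List σ → ℝ}
    (havg : ∀ u, ∑ a, F (u ++ [a]) = Fintype.card σ * F u) :
    ∀ (w u : List σ), (∀ v, F v ≤ F u) → F (u ++ w) = F u
  | [], u, _ => by simp
  | a :: w, u, hu => by
    have ha : F (u ++ [a]) = F u := eq_of_sum_eq_card_mul (fun a => hu _) (havg u) a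
    have := eq_append_of_isMax havg w (u ++ [a]) fun v => (hu v).trans_eq ha.symm
    simpa [ha] using this

end Averages

variable {Q σ : Type*} [Fintype Q]

theorem finite_range_of_zero_one {ι : Type*} {M : ι → Matrix Q Q ℝ}
    (hUn : ∀ w i j, M w i j = 0 ∨ M w i j = 1) : (Set.range M).Finite := by
  have : (Set.univ.pi fun _ : Q => Set.univ.pi fun _ : Q => ({0, 1} : Set ℝ)).Finite :=
    Set.Finite.pi fun _ => Set.Finite.pi fun _ => Set.toFinite _
  refine this.subset ?_
  rintro _ ⟨w, rfl⟩ i - j -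
  simpa using hUn w i j

/-- The weights of the columns of an unambiguous morphism have a positive maximum `m`, heaviest
columns are stable under the action, and some word is such that in all its extensions every
column has weight `0` or `m`. -/
theorem exists_max_weight [DecidableEq Q] [Nonempty Q] [Fintype σ] [Nonempty σ]
    {M : List σ → Matrix Q Q ℝ} (hM0 : M [] = 1) (hMm : ∀ u v, M (u ++ v) = M u * M v)
    (hUn : ∀ w i j, M w i j = 0 ∨ M w i j = 1) (hSC : ∀ p q : Q, ∃ w, M w p q = 1)
    {α : Q → ℝ} (hα : ∀ q, 0 < α q)
    (hαA : α ᵥ* ((Fintype.card σ : ℝ)⁻¹ • ∑ a : σ, M [a]) = α) :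
    ∃ m : ℝ, 0 < m ∧ (∀ w q, (α ᵥ* M w) q ≤ m) ∧
      (∀ u w q, (α ᵥ* M w) q = m → (α ᵥ* M (u ++ w)) q = m) ∧
      ∃ w₀, ∀ u v q, (α ᵥ* M (u ++ w₀ ++ v)) q = 0 ∨ (α ᵥ* M (u ++ w₀ ++ v)) q = m := by
  have hM_nonneg : ∀ w i j, 0 ≤ M w i j := fun w i j => by
    rcases hUn w i j with h | h <;> simp [h]
  have hexp : ∀ w q, (α ᵥ* M w) q = ∑ p, α p * M w p q := fun w q => rfl
  have hmul : ∀ u v q, (α ᵥ* M (u ++ v)) q = ∑ p, (α ᵥ* M u) p * M v p q := by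
    intro u v q
    rw [hMm, ← vecMul_vecMul]; rfl
  have hnn : ∀ w q, 0 ≤ (α ᵥ* M w) q := fun w q =>
    Finset.sum_nonneg fun p _ => mul_nonneg (hα p).le (hM_nonneg w p q)
  obtain ⟨⟨A, q₀⟩, ⟨⟨z, rfl⟩, -⟩, hmax⟩ := Set.exists_max_image
    (Set.range M ×ˢ (Set.univ : Set Q)) (fun p => (α ᵥ* p.1) p.2)
    ((finite_range_of_zero_one hUn).prod Set.finite_univ)
    ⟨(M [], Classical.arbitrary Q), ⟨[], rfl⟩, trivial⟩
  dsimp only at hmax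
  set m := (α ᵥ* M z) q₀
  have hle : ∀ w q, (α ᵥ* M w) q ≤ m := fun w q => hmax (M w, q) ⟨⟨w, rfl⟩, trivial⟩
  have hm0 : 0 < m := by
    refine lt_of_lt_of_le (hα q₀) ?_
    simpa [hM0] using hle [] q₀
  have hσ : (Fintype.card σ : ℝ) ≠ 0 := by simp
  have hsum : α ᵥ* ∑ a : σ, M [a] = (Fintype.card σ : ℝ) • α := by
    rw [vecMul_smul] at hαA
    conv_rhs => rw [← hαA]
    rw [smul_smul, mul_inv_cancel₀ hσ, one_smul]
  have hstab : ∀ u w q, (α ᵥ* M w) q = m → (α ᵥ* M (u ++ w)) q = m := by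
    intro u w q hw
    induction u with
    | nil => simpa using hw
    | cons a u ih =>
      refine eq_of_sum_eq_card_mul (f := fun a => (α ᵥ* M (a :: u ++ w)) q)
        (fun a => hle _ _) ?_ a
      have h1 : ∀ a : σ, α ᵥ* M (a :: u ++ w) = (α ᵥ* M [a]) ᵥ* M (u ++ w) := fun a => by
        rw [vecMul_vecMul, ← hMm]; rfl
      calc ∑ a : σ, (α ᵥ* M (a :: u ++ w)) q
          = (∑ a : σ, (α ᵥ* M [a]) ᵥ* M (u ++ w)) q := by
            rw [Finset.sum_apply]; exact Finset.sum_congr rfl fun a _ => by rw [h1]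
        _ = ((α ᵥ* ∑ a : σ, M [a]) ᵥ* M (u ++ w)) q := by
            rw [← sum_vecMul, vecMul_sum]
        _ = Fintype.card σ * m := by
            rw [hsum, smul_vecMul, Pi.smul_apply, ih, smul_eq_mul]
  have hzero : ∀ u w q, (α ᵥ* M w) q = 0 → (α ᵥ* M (u ++ w)) q = 0 := by
    intro u w q hw
    have hz : ∀ p, M w p q = 0 := fun p => by
      have := (Finset.sum_eq_zero_iff_of_nonneg fun p _ =>
        mul_nonneg (hα p).le (hM_nonneg w p q)).1 hw p (Finset.mem_univ p)
      exact (mul_eq_zero.1 this).resolve_left (hα p).ne'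
    rw [hmul]
    simp [hz]
  have hex : ∀ S : Finset Q, ∃ w, ∀ q ∈ S, (α ᵥ* M w) q = 0 ∨ (α ᵥ* M w) q = m := by
    intro S
    induction S using Finset.induction_on with
    | empty => exact ⟨[], by simp⟩
    | insert q S _ ih =>
      obtain ⟨w, hw⟩ := ih
      by_cases hq : ∃ p, M w p q = 1
      · obtain ⟨p, hp⟩ := hq
        obtain ⟨t, ht⟩ := hSC q₀ p
        refine ⟨z ++ (t ++ w), ?_⟩
        intro q' hq'
        rcases Finset.mem_insert.1 hq' with rfl | hq'
        · right
          refine le_antisymm (hle _ _) ?_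
          have h1 : 1 ≤ M (t ++ w) q₀ q' := by
            rw [hMm, mul_apply]
            refine le_trans ?_ (Finset.single_le_sum (f := fun j => M t q₀ j * M w j q')
              (fun j _ => mul_nonneg (hM_nonneg _ _ _) (hM_nonneg _ _ _)) (Finset.mem_univ p))
            simp [ht, hp]
          rw [hmul]
          refine le_trans ?_ (Finset.single_le_sum
            (f := fun j => (α ᵥ* M z) j * M (t ++ w) j q')
            (fun j _ => mul_nonneg (hnn _ _) (hM_nonneg _ _ _)) (Finset.mem_univ q₀))
          exact le_mul_of_one_le_right hm0.le h1
        · rw [← List.append_assoc]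
          exact (hw q' hq').imp (hzero _ _ _) (hstab _ _ _)
      · have hz : ∀ p, M w p q = 0 := fun p =>
          (hUn w p q).resolve_right fun h => hq ⟨p, h⟩
        refine ⟨w, fun q' hq' => ?_⟩
        rcases Finset.mem_insert.1 hq' with rfl | hq'
        · left; rw [hexp]; simp [hz]
        · exact hw q' hq'
  refine ⟨m, hm0, hle, hstab, ?_⟩
  obtain ⟨w, hw⟩ := hex Finset.univ
  refine ⟨w, fun u v q => ?_⟩
  have hu : ∀ p, (α ᵥ* M (u ++ w)) p = 0 ∨ (α ᵥ* M (u ++ w)) p = m := fun p =>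
    (hw p (Finset.mem_univ p)).imp (hzero _ _ _) (hstab _ _ _)
  by_cases h : ∃ p, (α ᵥ* M (u ++ w)) p = m ∧ M v p q = 1
  · obtain ⟨p, hp, hp'⟩ := h
    right
    refine le_antisymm (hle _ _) ?_
    rw [hmul]
    refine le_trans ?_ (Finset.single_le_sum
      (f := fun j => (α ᵥ* M (u ++ w)) j * M v j q)
      (fun j _ => mul_nonneg (hnn _ _) (hM_nonneg _ _ _)) (Finset.mem_univ p))
    simp [hp, hp']
  · left
    rw [hmul]
    refine Finset.sum_eq_zero fun p _ => ?_
    rcases hUn v p q with h' | h'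
    · simp [h']
    · rcases hu p with h'' | h''
      · simp [h'']
      · exact absurd ⟨p, h'', h'⟩ h

/-- The row version of `exists_max_weight`. -/
theorem exists_max_weight_row [DecidableEq Q] [Nonempty Q] [Fintype σ] [Nonempty σ]
    {M : List σ → Matrix Q Q ℝ} (hM0 : M [] = 1) (hMm : ∀ u v, M (u ++ v) = M u * M v)
    (hUn : ∀ w i j, M w i j = 0 ∨ M w i j = 1) (hSC : ∀ p q : Q, ∃ w, M w p q = 1)
    {β : Q → ℝ} (hβ : ∀ q, 0 < β q)
    (hβA : ((Fintype.card σ : ℝ)⁻¹ • ∑ a : σ, M [a]) *ᵥ β = β) :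
    ∃ m : ℝ, 0 < m ∧
      (∀ u w q, (M w *ᵥ β) q = m → (M (w ++ u) *ᵥ β) q = m) ∧
      ∃ w₀, ∀ u v q, (M (u ++ w₀ ++ v) *ᵥ β) q = 0 ∨ (M (u ++ w₀ ++ v) *ᵥ β) q = m := by
  obtain ⟨m, hm0, -, hstab, w₀, hw₀⟩ := exists_max_weight (M := fun w => (M w.reverse)ᵀ)
    (by simp [hM0]) (fun u v => by simp [hMm]) (fun w i j => hUn _ _ _)
    (fun p q => by
      obtain ⟨w, hw⟩ := hSC q p
      exact ⟨w.reverse, by simpa using hw⟩) hβ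
    (by
      have : ((Fintype.card σ : ℝ)⁻¹ • ∑ a : σ, (M [a].reverse)ᵀ) =
          ((Fintype.card σ : ℝ)⁻¹ • ∑ a : σ, M [a])ᵀ := by
        simp [transpose_sum]
      rw [this, vecMul_transpose, hβA])
  simp only [vecMul_transpose] at hstab hw₀
  refine ⟨m, hm0, fun u w q h => ?_, w₀.reverse, fun u v q => ?_⟩
  · simpa using hstab u.reverse w.reverse q (by simpa using h)
  · simpa using hw₀ v.reverse u.reverse q

/-- A column of maximal weight is a maximal column. -/
theorem isMaxCol_of_weight_eq {M : List σ → Matrix Q Q ℝ} {α : Q → ℝ} (hα : ∀ q, 0 < α q)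
    {m : ℝ} (hle : ∀ w q, (α ᵥ* M w) q ≤ m) {w : List σ} {q : Q} (h : (α ᵥ* M w) q = m) :
    IsMaxCol M fun p => M w p q := by
  refine ⟨⟨w, q, rfl⟩, ?_⟩
  rintro _ ⟨w', q', rfl⟩ hge
  have hle' : ∀ p ∈ Finset.univ, α p * M w p q ≤ α p * M w' p q' := fun p _ =>
    mul_le_mul_of_nonneg_left (hge p) (hα p).le
  have heq : ∑ p, α p * M w p q = ∑ p, α p * M w' p q' :=
    le_antisymm (Finset.sum_le_sum hle') ((hle w' q').trans_eq h.symm)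
  funext p
  have := (Finset.sum_eq_sum_iff_of_le hle').1 heq p (Finset.mem_univ p)
  exact (mul_left_cancel₀ (hα p).ne' this).symm

/-- If `U` contains every image of `M (u ++ x)`, then it contains the orbit of an averaging-invariant
vector. -/
theorem mulVec_mem_of_invariant [Fintype σ] [Nonempty σ]
    {M : List σ → Matrix Q Q ℝ} (hMm : ∀ u v, M (u ++ v) = M u * M v)
    (hUn : ∀ w i j, M w i j = 0 ∨ M w i j = 1)
    {β : Q → ℝ} (hβA : ((Fintype.card σ : ℝ)⁻¹ • ∑ a : σ, M [a]) *ᵥ β = β)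
    {U : Submodule ℝ (Q → ℝ)} {x : List σ} (hU : ∀ u, M (u ++ x) *ᵥ β ∈ U) (w : List σ) :
    M w *ᵥ β ∈ U := by
  have hσ : (Fintype.card σ : ℝ) ≠ 0 := by simp
  have hsum : (∑ a : σ, M [a]) *ᵥ β = (Fintype.card σ : ℝ) • β := by
    rw [smul_mulVec] at hβA
    conv_rhs => rw [← hβA]
    rw [smul_smul, mul_inv_cancel₀ hσ, one_smul]
  have key : ∀ f : (Q → ℝ) →ₗ[ℝ] ℝ, U ≤ LinearMap.ker f → ∀ w, f (M w *ᵥ β) ≤ 0 := by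
    intro f hf w
    obtain ⟨_, ⟨u, rfl⟩, hu⟩ := Set.exists_max_image (Set.range M) (fun A => f (A *ᵥ β))
      (finite_range_of_zero_one hUn) ⟨_, w, rfl⟩
    have hu' : ∀ v, f (M v *ᵥ β) ≤ f (M u *ᵥ β) := fun v => hu _ ⟨v, rfl⟩
    have := eq_append_of_isMax (F := fun v => f (M v *ᵥ β)) (fun v => by
      rw [← map_sum, ← smul_eq_mul, ← map_smul, ← mulVec_smul, ← hsum, mulVec_mulVec,
        Finset.mul_sum, sum_mulVec]
      simp only [hMm]) x u hu'
    refine (hu' w).trans_eq ?_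
    rw [← this]
    exact hf (hU u)
  by_contra hw
  obtain ⟨f, hfw, hf⟩ := Submodule.exists_le_ker_of_notMem hw
  refine hfw (le_antisymm (key f hf w) ?_)
  have := key (-f) (fun y hy => by simpa using hf hy) w
  simpa using this

/-- The unambiguous rank of a zero-one matrix is at most its number of distinct nonzero rows. -/
theorem rankUnMat_le_card {A : Matrix Q Q ℝ} (hA : ∀ i j, A i j = 0 ∨ A i j = 1)
    {T : Finset (Q → ℝ)} (hT : ∀ t ∈ T, ∃ p, A p = t) (hT' : ∀ p, A p ∉ T → A p = 0) :
    rankUnMat A ≤ T.card := by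
  classical
  refine Nat.sInf_le ⟨Matrix.of fun p i => if A p = T.equivFin.symm i then 1 else 0,
    Matrix.of fun i q => (T.equivFin.symm i : Q → ℝ) q, fun i j => ?_, fun i j => ?_, ?_⟩
  · by_cases h : A i = T.equivFin.symm j <;> simp [h]
  · obtain ⟨p, hp⟩ := hT _ (T.equivFin.symm i).2
    rw [of_apply, ← hp]
    exact hA p j
  · ext p q
    simp only [mul_apply, of_apply]
    rw [T.equivFin.symm.sum_comp
      (fun t : T => (if A p = t then (1 : ℝ) else 0) * (t : Q → ℝ) q),
      Finset.sum_coe_sort T (fun t => (if A p = t then (1 : ℝ) else 0) * t q)]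
    simp only [ite_mul, one_mul, zero_mul, Finset.sum_ite_eq]
    split_ifs with h
    · rfl
    · rw [hT' p h]; rfl

/-- If `V ≤ U`, and `Φ` maps `U` onto its codomain and `V` into a line, then
`dim V + dim (codomain) ≤ dim U + 1`. -/
theorem finrank_add_le_of_map {K E F : Type*} [Field K] [AddCommGroup E] [Module K E]
    [FiniteDimensional K E] [AddCommGroup F] [Module K F] (Φ : E →ₗ[K] F)
    {U V : Submodule K E} (hVU : V ≤ U) (hU : U.map Φ = ⊤) (c : F) (hV : V.map Φ ≤ K ∙ c) :
    Module.finrank K V + Module.finrank K F ≤ Module.finrank K U + 1 := by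
  have h1 := (Φ.domRestrict U).finrank_range_add_finrank_ker
  have h2 := (Φ.domRestrict V).finrank_range_add_finrank_ker
  rw [LinearMap.range_domRestrict] at h1 h2
  rw [hU, finrank_top] at h1
  have h3 : Module.finrank K (V.map Φ) ≤ 1 :=
    (Submodule.finrank_mono hV).trans (by
      simpa using finrank_span_le_card (R := K) ({c} : Set F))
  have h4 : Module.finrank K (LinearMap.ker (Φ.domRestrict V)) ≤
      Module.finrank K (LinearMap.ker (Φ.domRestrict U)) := by
    rw [← Submodule.finrank_map_subtype_eq, ← Submodule.finrank_map_subtype_eq U]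
    refine Submodule.finrank_mono ?_
    rintro _ ⟨y, hy, rfl⟩
    exact ⟨⟨y, hVU y.2⟩, hy, rfl⟩
  omega

/-- Let `A` be an idempotent zero-one matrix whose rows have `β`-weight `0` or `m`, the former
being zero. Then each row is, among the nonzero rows, supported on a single one, namely itself. -/
theorem exists_row_eq_of_idempotent {A : Matrix Q Q ℝ} (hA : ∀ i j, A i j = 0 ∨ A i j = 1)
    (hAA : A * A = A) {β : Q → ℝ} {m : ℝ} (hm : 0 < m)
    (hw : ∀ p, (A *ᵥ β) p = 0 ∨ (A *ᵥ β) p = m) (hz : ∀ p, (A *ᵥ β) p = 0 → A p = 0)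
    {p : Q} (hp : A p ≠ 0) :
    ∃ p₀, A p p₀ = 1 ∧ A p₀ = A p ∧ ∀ p', p' ≠ p₀ → A p p' = 0 ∨ A p' = 0 := by
  classical
  have hnn : ∀ p p', 0 ≤ A p p' * (A *ᵥ β) p' := fun p p' =>
    mul_nonneg (by rcases hA p p' with h | h <;> simp [h])
      (by rcases hw p' with h | h <;> simp [h, hm.le])
  have hpm : (A *ᵥ β) p = m := (hw p).resolve_left fun h => hp (hz p h)
  have hs : ∑ p', A p p' * (A *ᵥ β) p' = m := by
    rw [← hpm]
    conv_rhs => rw [← hAA, ← mulVec_mulVec]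
    rfl
  obtain ⟨p₀, -, hp₀⟩ := Finset.exists_ne_zero_of_sum_ne_zero (hs.trans_ne hm.ne')
  have h1 : A p p₀ = 1 := (hA p p₀).resolve_left (left_ne_zero_of_mul hp₀)
  have h2 : (A *ᵥ β) p₀ = m := (hw p₀).resolve_left (right_ne_zero_of_mul hp₀)
  have hrest : ∀ p', p' ≠ p₀ → A p p' = 0 ∨ A p' = 0 := by
    intro p' hp'
    rw [← Finset.add_sum_erase _ _ (Finset.mem_univ p₀), h1, h2, one_mul, add_eq_left] at hs
    have := (Finset.sum_eq_zero_iff_of_nonneg fun i _ => hnn p i).1 hs p' (by simp [hp'])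
    exact (mul_eq_zero.1 this).imp_right (hz p')
  refine ⟨p₀, h1, ?_, hrest⟩
  funext q
  have : A p q = ∑ p', A p p' * A p' q := by
    conv_lhs => rw [← hAA]
    rfl
  rw [this, Finset.sum_eq_single p₀ (fun p' _ hp' => by
    rcases hrest p' hp' with h | h <;> simp [h]) (by simp), h1, one_mul]

end UFA

theorem dimV_add_rank_le {Q σ : Type*} [Fintype Q] [DecidableEq Q] [Nonempty Q]
    [Fintype σ] [Nonempty σ]
    (M : List σ → Matrix Q Q ℝ)
    (hM0 : M [] = 1) (hMm : ∀ u v, M (u ++ v) = M u * M v)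
    (hUn : ∀ w i j, M w i j = 0 ∨ M w i j = 1)
    (hComp : ∀ w, M w ≠ 0)
    (hSC : ∀ p q : Q, ∃ w, M w p q = 1)
    (α β : Q → ℝ) (hα : ∀ q, 0 < α q) (hβ : ∀ q, 0 < β q)
    (hαA : α ᵥ* ((Fintype.card σ : ℝ)⁻¹ • ∑ a : σ, M [a]) = α)
    (hβA : ((Fintype.card σ : ℝ)⁻¹ • ∑ a : σ, M [a]) *ᵥ β = β)
    (hαβ : α ⬝ᵥ β = 1)
 :
    Module.finrank ℝ (Submodule.span ℝ {y : Q → ℝ | ∃ w : List σ, y = M w *ᵥ β})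
      + UFA.rankUn M - 1
      ≤ Module.finrank ℝ (Submodule.span ℝ {y : Q → ℝ | UFA.IsMaxCol M y}) := by
  classical
  obtain ⟨m, hm, hle, -, w₁, hw₁⟩ := UFA.exists_max_weight hM0 hMm hUn hSC hα hαA
  obtain ⟨n, hn, hstab, w₂, hw₂⟩ := UFA.exists_max_weight_row hM0 hMm hUn hSC hβ hβA
  have hM_nonneg : ∀ w i j, 0 ≤ M w i j := fun w i j => by
    rcases hUn w i j with h | h <;> simp [h]
  have hpow : ∀ k : ℕ, ∃ x, M x = M (w₁ ++ w₂) ^ k := by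
    intro k
    induction k with
    | zero => exact ⟨[], by simp [hM0]⟩
    | succ k ih =>
      obtain ⟨x, hx⟩ := ih
      exact ⟨x ++ (w₁ ++ w₂), by rw [hMm, hx, pow_succ]⟩
  obtain ⟨k, hk⟩ := UFA.exists_isIdempotentElem_pow (M (w₁ ++ w₂))
    ((UFA.finite_range_of_zero_one hUn).subset (by
      rintro _ ⟨k, rfl⟩
      exact hpow k))
  obtain ⟨y, hy⟩ := hpow k
  set x := y ++ (w₁ ++ w₂) with hx
  have hxx : M x * M x = M x := by
    have : M x = M (w₁ ++ w₂) ^ (k + 1) := by rw [hx, hMm, hy, pow_succ]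
    rw [this]
    exact hk
  set U := Submodule.span ℝ {y : Q → ℝ | UFA.IsMaxCol M y}
  have hcol : ∀ u q, (fun p => M (u ++ x) p q) ∈ U := by
    intro u q
    have h := hw₁ (u ++ y) w₂ q
    rw [show u ++ y ++ w₁ ++ w₂ = u ++ x by simp [hx]] at h
    rcases h with h | h
    · have hz : (fun p => M (u ++ x) p q) = 0 := by
        funext p
        have := (Finset.sum_eq_zero_iff_of_nonneg fun p _ =>
          mul_nonneg (hα p).le (hM_nonneg (u ++ x) p q)).1 h p (Finset.mem_univ p)
        exact (mul_eq_zero.1 this).resolve_left (hα p).ne'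
      rw [hz]
      exact U.zero_mem
    · exact Submodule.subset_span (UFA.isMaxCol_of_weight_eq hα hle h)
  have himg : ∀ u v, M (u ++ x) *ᵥ v ∈ U := by
    intro u v
    rw [mulVec_eq_sum]
    exact Submodule.sum_mem _ fun q _ => by
      rw [op_smul_eq_smul]
      exact U.smul_mem (v q) (hcol u q)
  have hVU : Submodule.span ℝ {y : Q → ℝ | ∃ w : List σ, y = M w *ᵥ β} ≤ U := by
    refine Submodule.span_le.2 ?_
    rintro _ ⟨w, rfl⟩
    exact UFA.mulVec_mem_of_invariant hMm hUn hβA (fun u => himg u β) w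
  have hrow : ∀ p, (M x *ᵥ β) p = 0 ∨ (M x *ᵥ β) p = n := by
    intro p
    simpa [hx] using hw₂ (y ++ w₁) [] p
  have hrow0 : ∀ p, (M x *ᵥ β) p = 0 → M x p = 0 := by
    intro p h
    funext q
    have := (Finset.sum_eq_zero_iff_of_nonneg fun q _ =>
      mul_nonneg (hM_nonneg x p q) (hβ q).le).1 h q (Finset.mem_univ q)
    exact (mul_eq_zero.1 this).resolve_right (hβ q).ne'
  set T : Finset (Q → ℝ) := (Finset.univ.image fun p => M x p).filter (· ≠ 0) with hT
  have hTmem : ∀ t, t ∈ T ↔ (∃ p, M x p = t) ∧ t ≠ 0 := by simp [hT]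
  let Φ : (Q → ℝ) →ₗ[ℝ] (T → ℝ) := (Matrix.of fun t : T => (t : Q → ℝ)).mulVecLin
  have hΦ : ∀ (v : Q → ℝ) (t : T) (p : Q), M x p = t → Φ v t = (M x *ᵥ v) p := by
    intro v t p hp
    change (t : Q → ℝ) ⬝ᵥ v = M x p ⬝ᵥ v
    rw [hp]
  have hsurj : U.map Φ = ⊤ := by
    refine eq_top_iff.2 fun c _ => ?_
    let v : Q → ℝ := fun p => if h : M x p ∈ T then c ⟨M x p, h⟩ else 0
    refine ⟨M x *ᵥ v, himg [] v, ?_⟩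
    funext t
    obtain ⟨⟨p, hp⟩, ht0⟩ := (hTmem t).1 t.2
    obtain ⟨p₀, h1, h2, h3⟩ := UFA.exists_row_eq_of_idempotent (hUn x) hxx hn hrow hrow0
      (p := p) (hp.trans_ne ht0)
    rw [hΦ _ t p hp, mulVec_mulVec, hxx]
    change ∑ p', M x p p' * v p' = c t
    rw [Finset.sum_eq_single p₀ (fun p' _ hp' => ?_) (by simp), h1, one_mul]
    · have h4 : M x p₀ = t := h2.trans hp
      simp [v, h4]
    · rcases h3 p' hp' with h | h
      · simp [h]
      · have : M x p' ∉ T := fun h' => ((hTmem _).1 h').2 h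
        simp [v, this]
  have hline : (Submodule.span ℝ {y : Q → ℝ | ∃ w : List σ, y = M w *ᵥ β}).map Φ ≤
      Submodule.span ℝ {fun _ : T => n} := by
    rw [Submodule.map_span, Submodule.span_le]
    rintro _ ⟨_, ⟨w, rfl⟩, rfl⟩
    refine Submodule.subset_span (Set.mem_singleton_iff.2 ?_)
    funext t
    obtain ⟨⟨p, hp⟩, ht0⟩ := (hTmem t).1 t.2
    rw [hΦ _ t p hp, mulVec_mulVec, ← hMm]
    exact hstab w x p ((hrow p).resolve_left fun h => ht0 (hp.symm.trans (hrow0 p h)))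
  have hfin := UFA.finrank_add_le_of_map Φ hVU hsurj _ hline
  have hrank : UFA.rankUn M ≤ T.card :=
    (Nat.sInf_le (Set.mem_range_self x)).trans (UFA.rankUnMat_le_card (hUn x) (fun t ht => ((hTmem t).1 ht).1)
      fun p hp => by
        by_contra h
        exact hp ((hTmem _).2 ⟨⟨p, rfl⟩, h⟩))
  rw [Module.finrank_fintype_fun_eq_card, Fintype.card_coe] at hfin
  omega
end

section
/- Let S ⊆ Q be such that [S] is a column whose weight α^T [S] is strictly less than mcw. Then (a) there exists S' ⊆ Q with S ⊊ S' such that [S'] is a column with α^T [S'] = mcw, and (b) there exists a word u ∈ Σ* with M(u)[S] = 0. -/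
open Matrix

namespace UFA

variable {Q σ : Type*}

theorem IsCol.mulVec [Fintype Q] {M : List σ → Matrix Q Q ℝ} (hMm : ∀ u v, M (u ++ v) = M u * M v)
    {y : Q → ℝ} (hy : IsCol M y) (u : List σ) : IsCol M (M u *ᵥ y) := by
  obtain ⟨w, q, rfl⟩ := hy
  refine ⟨u ++ w, q, ?_⟩
  rw [hMm]
  rfl

theorem IsCol.eq_zero_or_one {M : List σ → Matrix Q Q ℝ}
    (hUn : ∀ w i j, M w i j = 0 ∨ M w i j = 1)
    {y : Q → ℝ} (hy : IsCol M y) (p : Q) : y p = 0 ∨ y p = 1 := by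
  obtain ⟨w, q, rfl⟩ := hy
  exact hUn w p q

/-- Since `α` is invariant under the average of the generators, the weight of a column of maximum
weight is preserved by the action of every word. -/
theorem weight_mulVec_eq [Fintype Q] [DecidableEq Q] [Fintype σ] [Nonempty σ]
    {M : List σ → Matrix Q Q ℝ}
    (hM0 : M [] = 1) (hMm : ∀ u v, M (u ++ v) = M u * M v) {α : Q → ℝ}
    (hαA : α ᵥ* ((Fintype.card σ : ℝ)⁻¹ • ∑ a : σ, M [a]) = α) {m : ℝ}
    (hm : ∀ y, IsCol M y → α ⬝ᵥ y ≤ m) {y : Q → ℝ} (hy : IsCol M y) (hyw : α ⬝ᵥ y = m)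
    (u : List σ) : α ⬝ᵥ (M u *ᵥ y) = m := by
  induction u with
  | nil => simpa [hM0] using hyw
  | cons a u ih =>
    have hcol := hy.mulVec hMm u
    have hcard : (Fintype.card σ : ℝ) ≠ 0 := by simp
    have hsum : ∑ b : σ, α ⬝ᵥ (M [b] *ᵥ (M u *ᵥ y)) = ∑ _b : σ, m := by
      have h : α ⬝ᵥ (((Fintype.card σ : ℝ)⁻¹ • ∑ a : σ, M [a]) *ᵥ (M u *ᵥ y)) = m := by
        rw [dotProduct_mulVec, hαA, ih]
      rw [smul_mulVec, dotProduct_smul, sum_mulVec, dotProduct_sum, smul_eq_mul,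
        inv_mul_eq_iff_eq_mul₀ hcard] at h
      rw [h, Finset.sum_const, Finset.card_univ, nsmul_eq_mul]
    have h := (Finset.sum_eq_sum_iff_of_le fun b _ => hm _ (hcol.mulVec hMm [b])).1 hsum
      a (Finset.mem_univ a)
    rwa [mulVec_mulVec, ← hMm] at h

/-- Every state lies in some column of maximum weight. -/
theorem exists_weight_eq_apply_eq_one [Fintype Q] [DecidableEq Q] [Fintype σ] [Nonempty σ]
    {M : List σ → Matrix Q Q ℝ}
    (hM0 : M [] = 1) (hMm : ∀ u v, M (u ++ v) = M u * M v)
    (hUn : ∀ w i j, M w i j = 0 ∨ M w i j = 1) (hSC : ∀ p q : Q, ∃ w, M w p q = 1) {α : Q → ℝ}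
    (hαA : α ᵥ* ((Fintype.card σ : ℝ)⁻¹ • ∑ a : σ, M [a]) = α) {m : ℝ} (hm0 : 0 < m)
    (hm : ∀ y, IsCol M y → α ⬝ᵥ y ≤ m) {y : Q → ℝ} (hy : IsCol M y) (hyw : α ⬝ᵥ y = m)
    (q : Q) : ∃ y', IsCol M y' ∧ α ⬝ᵥ y' = m ∧ y' q = 1 := by
  obtain ⟨t, ht⟩ : ∃ t, y t ≠ 0 := by
    by_contra! h
    simp [dotProduct, h] at hyw
    exact hm0.ne hyw
  replace ht := (hy.eq_zero_or_one hUn t).resolve_left ht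
  obtain ⟨x, hx⟩ := hSC q t
  have hcol := hy.mulVec hMm x
  refine ⟨M x *ᵥ y, hcol, weight_mulVec_eq hM0 hMm hαA hm hy hyw x,
    (hcol.eq_zero_or_one hUn q).resolve_left (ne_of_gt ?_)⟩
  refine Finset.sum_pos' (fun i _ => mul_nonneg ?_ ?_) ⟨t, Finset.mem_univ t, by simp [hx, ht]⟩
  · rcases hUn x q i with h | h <;> simp [h]
  · rcases hy.eq_zero_or_one hUn i with h | h <;> simp [h]

end UFA

theorem non_max_column {Q σ : Type*} [Fintype Q] [DecidableEq Q] [Nonempty Q]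
    [Fintype σ] [Nonempty σ]
    (M : List σ → Matrix Q Q ℝ)
    (hM0 : M [] = 1) (hMm : ∀ u v, M (u ++ v) = M u * M v)
    (hUn : ∀ w i j, M w i j = 0 ∨ M w i j = 1)
    (hComp : ∀ w, M w ≠ 0)
    (hSC : ∀ p q : Q, ∃ w, M w p q = 1)
    (α β : Q → ℝ) (hα : ∀ q, 0 < α q) (hβ : ∀ q, 0 < β q)
    (hαA : α ᵥ* ((Fintype.card σ : ℝ)⁻¹ • ∑ a : σ, M [a]) = α)
    (hβA : ((Fintype.card σ : ℝ)⁻¹ • ∑ a : σ, M [a]) *ᵥ β = β)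
    (hαβ : α ⬝ᵥ β = 1)
    (mcw : ℝ) (hmcw₁ : ∃ y, UFA.IsCol M y ∧ α ⬝ᵥ y = mcw)
    (hmcw₂ : ∀ y, UFA.IsCol M y → α ⬝ᵥ y ≤ mcw)
    (S : Set Q) (hS : UFA.IsCol M (ind S)) (hSw : α ⬝ᵥ ind S < mcw) :
    (∃ S' : Set Q, S ⊂ S' ∧ UFA.IsCol M (ind S') ∧ α ⬝ᵥ ind S' = mcw) ∧
    (∃ u : List σ, M u *ᵥ ind S = 0) := by
  have hnn : ∀ w i j, 0 ≤ M w i j := fun w i j => by rcases hUn w i j with h | h <;> simp [h]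
  obtain ⟨w, q, hwq⟩ := hS
  obtain ⟨y₀, hy₀, hy₀w⟩ := hmcw₁
  have hm0 : 0 < mcw := by
    refine lt_of_le_of_lt ?_ hSw
    rw [hwq]
    exact Finset.sum_nonneg fun i _ => mul_nonneg (hα i).le (hnn w i q)
  obtain ⟨y, hy, hyw, hyq⟩ :=
    UFA.exists_weight_eq_apply_eq_one hM0 hMm hUn hSC hαA hm0 hmcw₂ hy₀ hy₀w q
  have hynn : ∀ i, 0 ≤ y i := fun i => by
    rcases hy.eq_zero_or_one hUn i with h | h <;> simp [h]
  have hpres := UFA.weight_mulVec_eq hM0 hMm hαA hmcw₂ hy hyw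
  have hcol := hy.mulVec hMm w
  have hle : ∀ p, M w p q ≤ (M w *ᵥ y) p := fun p => by
    have h := Finset.single_le_sum (f := fun i => M w p i * y i)
      (fun i _ => mul_nonneg (hnn w p i) (hynn i)) (Finset.mem_univ q)
    rwa [hyq, mul_one] at h
  refine ⟨?_, ?_⟩
  · have hind : ind {p | (M w *ᵥ y) p = 1} = M w *ᵥ y := by
      ext p
      rcases hcol.eq_zero_or_one hUn p with h | h <;> simp [ind, Set.indicator, h]
    refine ⟨{p | (M w *ᵥ y) p = 1}, ?_, by rwa [hind], by rw [hind, hpres w]⟩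
    refine ssubset_of_subset_of_ne (fun p hp => ?_) fun h => ?_
    · have h1 : M w p q = 1 := by
        rw [← congrFun hwq p]
        simp [ind, hp]
      refine (hcol.eq_zero_or_one hUn p).resolve_left fun h0 => ?_
      have := hle p
      linarith
    · rw [h, hind, hpres w] at hSw
      exact lt_irrefl _ hSw
  · obtain ⟨p, hp⟩ : ∃ p, M w p q ≠ (M w *ᵥ y) p := by
      by_contra! h
      rw [hwq, funext h, hpres w] at hSw
      exact lt_irrefl _ hSw
    obtain ⟨q', hq'q, hwq', hyq'⟩ : ∃ q', q' ≠ q ∧ M w p q' = 1 ∧ y q' = 1 := by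
      by_contra! h
      refine hp ?_
      rw [mulVec, dotProduct, Finset.sum_eq_single q, hyq, mul_one]
      · intro i _ hi
        rcases hUn w p i with h0 | h1
        · simp [h0]
        · simp [(hy.eq_zero_or_one hUn i).resolve_right (h i hi h1)]
      · simp
    obtain ⟨v, t, rfl⟩ := hy₀
    obtain ⟨z, hz⟩ := hSC t p
    have hvzw : ∀ i, M v i t ≤ M (v ++ (z ++ w)) i q' := fun i => by
      have h1 : 1 ≤ M (z ++ w) t q' := by
        rw [hMm, mul_apply]
        have h := Finset.single_le_sum (f := fun j => M z t j * M w j q')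
          (fun j _ => mul_nonneg (hnn z t j) (hnn w j q')) (Finset.mem_univ p)
        simpa [hz, hwq'] using h
      rw [hMm, mul_apply]
      have h := Finset.single_le_sum (f := fun j => M v i j * M (z ++ w) j q')
        (fun j _ => mul_nonneg (hnn v i j) (hnn _ j q')) (Finset.mem_univ t)
      exact (le_mul_of_one_le_right (hnn v i t) h1).trans h
    have hadd : ∀ i, M (v ++ (z ++ w)) i q + M v i t ≤ (M (v ++ (z ++ w)) *ᵥ y) i := fun i => by
      have h := Finset.add_le_sum (f := fun j => M (v ++ (z ++ w)) i j * y j)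
        (fun j _ => mul_nonneg (hnn _ i j) (hynn j)) (Finset.mem_univ q) (Finset.mem_univ q')
        hq'q.symm
      simp only [hyq, hyq', mul_one] at h
      exact (add_le_add_right (hvzw i) _).trans h
    have hzero : ∑ i, α i * M (v ++ (z ++ w)) i q = 0 := by
      refine le_antisymm ?_ (Finset.sum_nonneg fun i _ => mul_nonneg (hα i).le (hnn _ i q))
      have h := Finset.sum_le_sum fun i (_ : i ∈ Finset.univ) =>
        mul_le_mul_of_nonneg_left (hadd i) (hα i).le
      simp only [mul_add, Finset.sum_add_distrib] at h
      have h2 := hpres (v ++ (z ++ w))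
      simp only [dotProduct] at h2 hy₀w
      linarith
    rw [Finset.sum_eq_zero_iff_of_nonneg fun i _ => mul_nonneg (hα i).le (hnn _ i q)] at hzero
    refine ⟨v ++ z, ?_⟩
    ext i
    have h := (mul_eq_zero.1 (hzero i (Finset.mem_univ i))).resolve_left (hα i).ne'
    rw [← List.append_assoc, hMm] at h
    rw [hwq]
    exact h
end
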